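/- arXiv:2211.14803 — 2 statements merged into one kernel-verified Lean document; each statement's English description precedes it below -/
import Mathlib

section
/- Let H ∈ (1/4,1/2). There exists a constant C_H > 0, depending only on H, such that for every t > 0: ∫_ℝ∫_ℝ |G(t, x+h) − G(t, x)|^2 · |h|^{2H−2} dh dx ≤ C_H · t^{2H}. -/
open MeasureTheory

/-- The one-dimensional wave kernel `G(t,x) = (1/2)·1_{|x|<t}`. -/
noncomputable def G (t x : ℝ) : ℝ := if |x| < t then 1 / 2 else 0

theorem measurable_G (t : ℝ) : Measurable (G t) := by
  unfold G
  exact Measurable.ite (measurableSet_lt (by fun_prop) (by fun_prop))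
    measurable_const measurable_const

theorem sq_G_sub_le (t x y : ℝ) : (G t y - G t x) ^ 2 ≤ 1 / 4 := by
  unfold G
  split_ifs <;> norm_num

/-- If the increments `G t (x + h) - G t x` vanish off two closed intervals of length `2 * r`,
their squared `L²` norm is at most `r`. -/
theorem lintegral_sq_G_sub_le_of_support {t h r a b : ℝ} (hr : 0 ≤ r)
    (hS : ∀ x, x ∉ Set.Icc (a - r) (a + r) ∪ Set.Icc (b - r) (b + r) → G t (x + h) = G t x) :
    ∫⁻ x : ℝ, ENNReal.ofReal ((G t (x + h) - G t x) ^ 2) ≤ ENNReal.ofReal r := by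
  set S := Set.Icc (a - r) (a + r) ∪ Set.Icc (b - r) (b + r) with hSdef
  have hSm : MeasurableSet S := measurableSet_Icc.union measurableSet_Icc
  calc ∫⁻ x : ℝ, ENNReal.ofReal ((G t (x + h) - G t x) ^ 2)
      ≤ ∫⁻ x : ℝ, S.indicator (fun _ => ENNReal.ofReal (1 / 4)) x := by
        refine lintegral_mono fun x => ?_
        by_cases hx : x ∈ S
        · rw [Set.indicator_of_mem hx]
          exact ENNReal.ofReal_le_ofReal (sq_G_sub_le t x (x + h))
        · simp [hS x hx]
    _ = ENNReal.ofReal (1 / 4) * volume S := lintegral_indicator_const hSm _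
    _ ≤ ENNReal.ofReal (1 / 4) * (ENNReal.ofReal (2 * r) + ENNReal.ofReal (2 * r)) := by
        gcongr
        refine (measure_union_le _ _).trans (le_of_eq ?_)
        rw [Real.volume_Icc, Real.volume_Icc]
        ring_nf
    _ = ENNReal.ofReal r := by
        rw [← ENNReal.ofReal_add (by positivity) (by positivity),
          ← ENNReal.ofReal_mul (by norm_num)]
        ring_nf

theorem lintegral_sq_G_sub_le {t : ℝ} (ht : 0 < t) (h : ℝ) :
    ∫⁻ x : ℝ, ENNReal.ofReal ((G t (x + h) - G t x) ^ 2) ≤ ENNReal.ofReal (min |h| t) := by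
  rcases le_total |h| t with hle | hle
  · rw [min_eq_left hle]
    refine lintegral_sq_G_sub_le_of_support (a := t) (b := -t) (abs_nonneg h) fun x hx => ?_
    simp only [Set.mem_union, Set.mem_Icc, not_or, not_and_or, not_le] at hx
    have h1 := le_abs_self h
    have h2 := neg_abs_le h
    have : |x + h| < t ↔ |x| < t := by
      rw [abs_lt, abs_lt]
      obtain ⟨h3 | h3, h4 | h4⟩ := hx <;> constructor <;> rintro ⟨_, _⟩ <;>
        constructor <;> linarith
    simp [G, this]
  · rw [min_eq_right hle]
    refine lintegral_sq_G_sub_le_of_support (a := 0) (b := -h) ht.le fun x hx => ?_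
    simp only [Set.mem_union, Set.mem_Icc, not_or] at hx
    have h1 : ¬ |x| < t := fun hx' => hx.1 (by
      rw [abs_lt] at hx'; constructor <;> linarith [hx'.1, hx'.2])
    have h2 : ¬ |x + h| < t := fun hx' => hx.2 (by
      rw [abs_lt] at hx'; constructor <;> linarith [hx'.1, hx'.2])
    simp [G, h1, h2]

theorem lintegral_Ioi_min_mul_rpow_le {H t : ℝ} (hH0 : 0 < H) (hH1 : H < 1 / 2) (ht : 0 < t) :
    ∫⁻ h in Set.Ioi (0 : ℝ), ENNReal.ofReal (min h t * h ^ (2 * H - 2)) ≤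
      ENNReal.ofReal ((1 / (2 * H) + 1 / (1 - 2 * H)) * t ^ (2 * H)) := by
  have hnear : ∫⁻ h in Set.Ioc 0 t, ENNReal.ofReal (min h t * h ^ (2 * H - 2)) ≤
      ENNReal.ofReal (1 / (2 * H) * t ^ (2 * H)) := by
    have hint : IntegrableOn (fun h : ℝ => h ^ (2 * H - 1)) (Set.Ioc 0 t) :=
      (intervalIntegrable_iff_integrableOn_Ioc_of_le ht.le).1
        (intervalIntegral.intervalIntegrable_rpow' (by linarith))
    calc ∫⁻ h in Set.Ioc 0 t, ENNReal.ofReal (min h t * h ^ (2 * H - 2))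
        = ∫⁻ h in Set.Ioc 0 t, ENNReal.ofReal (h ^ (2 * H - 1)) := by
          refine setLIntegral_congr_fun measurableSet_Ioc fun h hh => ?_
          have h1 : h ^ (2 * H - 1) = h * h ^ (2 * H - 2) := by
            rw [show 2 * H - 1 = 1 + (2 * H - 2) by ring, Real.rpow_add hh.1, Real.rpow_one]
          simp only [min_eq_left hh.2, h1]
      _ = ENNReal.ofReal (∫ h in Set.Ioc 0 t, h ^ (2 * H - 1)) := by
          refine (ofReal_integral_eq_lintegral_ofReal hint ?_).symm
          filter_upwards [ae_restrict_mem measurableSet_Ioc] with h hh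
          exact Real.rpow_nonneg hh.1.le _
      _ ≤ _ := by
          rw [← intervalIntegral.integral_of_le ht.le, integral_rpow (Or.inl (by linarith)),
            show 2 * H - 1 + 1 = 2 * H by ring, Real.zero_rpow (by linarith)]
          refine ENNReal.ofReal_le_ofReal (le_of_eq ?_)
          ring
  have hfar : ∫⁻ h in Set.Ioi t, ENNReal.ofReal (min h t * h ^ (2 * H - 2)) ≤
      ENNReal.ofReal (1 / (1 - 2 * H) * t ^ (2 * H)) := by
    have hint : IntegrableOn (fun h : ℝ => t * h ^ (2 * H - 2)) (Set.Ioi t) :=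
      (integrableOn_Ioi_rpow_of_lt (by linarith) ht).const_mul t
    calc ∫⁻ h in Set.Ioi t, ENNReal.ofReal (min h t * h ^ (2 * H - 2))
        = ∫⁻ h in Set.Ioi t, ENNReal.ofReal (t * h ^ (2 * H - 2)) := by
          refine setLIntegral_congr_fun measurableSet_Ioi fun h hh => ?_
          simp only [min_eq_right (le_of_lt (Set.mem_Ioi.1 hh))]
      _ = ENNReal.ofReal (∫ h in Set.Ioi t, t * h ^ (2 * H - 2)) := by
          refine (ofReal_integral_eq_lintegral_ofReal hint ?_).symm
          filter_upwards [ae_restrict_mem measurableSet_Ioi] with h hh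
          exact mul_nonneg ht.le (Real.rpow_nonneg (ht.trans hh).le _)
      _ ≤ _ := by
          rw [integral_const_mul, integral_Ioi_rpow_of_lt (by linarith) ht]
          refine ENNReal.ofReal_le_ofReal (le_of_eq ?_)
          have h1 : t ^ (2 * H) = t * t ^ (2 * H - 2 + 1) := by
            conv_lhs => rw [show 2 * H = 1 + (2 * H - 2 + 1) by ring]
            rw [Real.rpow_add ht, Real.rpow_one]
          have h2 : 1 - 2 * H ≠ 0 := by linarith
          have h3 : 2 * H - 2 + 1 = -(1 - 2 * H) := by ring
          rw [h1, h3, neg_div_neg_eq]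
          ring
  have h1 : 0 < 1 - 2 * H := by linarith
  rw [← Set.Ioc_union_Ioi_eq_Ioi ht.le, add_mul, ENNReal.ofReal_add (by positivity) (by positivity)]
  exact (lintegral_union_le _ _ _).trans (add_le_add hnear hfar)

/-- An even function vanishing at `0` has integral at most twice its integral over `(0, ∞)`. -/
theorem lintegral_comp_abs_le {f : ℝ → ENNReal} (hf : Measurable f) (hf0 : f 0 = 0) :
    ∫⁻ h : ℝ, f |h| ≤ 2 * ∫⁻ h in Set.Ioi (0 : ℝ), f h := by
  set g := (Set.Ioi (0 : ℝ)).indicator f with hg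
  have hgm : Measurable g := hf.indicator measurableSet_Ioi
  calc ∫⁻ h : ℝ, f |h| ≤ ∫⁻ h : ℝ, (g h + g (-h)) := by
        refine lintegral_mono fun h => ?_
        rcases lt_trichotomy h 0 with hh | rfl | hh
        · simp [hg, abs_of_neg hh, hh]
        · simp [hf0]
        · simp [hg, abs_of_pos hh, hh]
    _ = 2 * ∫⁻ h in Set.Ioi (0 : ℝ), f h := by
        rw [lintegral_add_left hgm, lintegral_neg_eq_self, hg,
          lintegral_indicator measurableSet_Ioi, two_mul]

theorem stmt5 (H : ℝ) (hH : H ∈ Set.Ioo (1 / 4 : ℝ) (1 / 2 : ℝ)) :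
    ∃ C : ℝ, 0 < C ∧ ∀ t : ℝ, 0 < t →
      (∫⁻ x : ℝ, ∫⁻ h : ℝ, ENNReal.ofReal ((G t (x + h) - G t x) ^ 2 * |h| ^ (2 * H - 2)))
        ≤ ENNReal.ofReal (C * t ^ (2 * H)) := by
  obtain ⟨hH0, hH1⟩ := hH
  have hH0' : 0 < H := by linarith
  have hH1' : 0 < 1 - 2 * H := by linarith
  refine ⟨2 * (1 / (2 * H) + 1 / (1 - 2 * H)), by positivity, fun t ht => ?_⟩
  have hG := measurable_G t
  rw [lintegral_lintegral_swap (by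
    refine Measurable.aemeasurable ?_
    simp only [Function.uncurry_def]
    fun_prop)]
  calc ∫⁻ h : ℝ, ∫⁻ x : ℝ, ENNReal.ofReal ((G t (x + h) - G t x) ^ 2 * |h| ^ (2 * H - 2))
      ≤ ∫⁻ h : ℝ, ENNReal.ofReal (min |h| t * |h| ^ (2 * H - 2)) := by
        refine lintegral_mono fun h => ?_
        simp only [ENNReal.ofReal_mul (sq_nonneg _)]
        rw [lintegral_mul_const _ (by fun_prop),
          ENNReal.ofReal_mul (le_min (abs_nonneg h) ht.le)]
        gcongr
        exact lintegral_sq_G_sub_le ht h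
    _ ≤ 2 * ∫⁻ h in Set.Ioi (0 : ℝ), ENNReal.ofReal (min h t * h ^ (2 * H - 2)) :=
        lintegral_comp_abs_le (f := fun h => ENNReal.ofReal (min h t * h ^ (2 * H - 2)))
          (by fun_prop) (by simp [ht.le])
    _ ≤ 2 * ENNReal.ofReal ((1 / (2 * H) + 1 / (1 - 2 * H)) * t ^ (2 * H)) := by
        gcongr
        exact lintegral_Ioi_min_mul_rpow_le hH0' hH1 ht
    _ = ENNReal.ofReal (2 * (1 / (2 * H) + 1 / (1 - 2 * H)) * t ^ (2 * H)) := by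
        rw [mul_assoc, ENNReal.ofReal_mul zero_le_two, ENNReal.ofReal_ofNat]
end

section
/- Let H ∈ (1/4,1/2). There exists a constant C_H > 0, depending only on H, such that for every t > 0: ∫_ℝ∫_ℝ∫_ℝ |G(t, x+y+h) − G(t, x+y) − G(t, x+h) + G(t, x)|^2 · |y|^{2H−2} · |h|^{2H−2} dy dh dx ≤ C_H · t^{4H−1}. -/
open MeasureTheory

theorem lintegral_rotate {μ ν ρ : Measure ℝ} [SFinite μ] [SFinite ν] [SFinite ρ]
    {F : ℝ → ℝ → ℝ → ENNReal}
    (hF : Measurable fun p : (ℝ × ℝ) × ℝ => F p.1.1 p.1.2 p.2) :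
    (∫⁻ x, ∫⁻ h, ∫⁻ y, F x h y ∂ρ ∂ν ∂μ) = ∫⁻ h, ∫⁻ y, ∫⁻ x, F x h y ∂μ ∂ρ ∂ν := by
  rw [lintegral_lintegral_swap (f := fun x h => ∫⁻ y, F x h y ∂ρ)
    hF.lintegral_prod_right'.aemeasurable]
  refine lintegral_congr fun h => ?_
  rw [lintegral_lintegral_swap]
  have : Measurable fun p : ℝ × ℝ => F p.1 h p.2 :=
    hF.comp (by fun_prop : Measurable fun p : ℝ × ℝ => ((p.1, h), p.2))
  exact this.aemeasurable

theorem G_nonneg (t x : ℝ) : 0 ≤ G t x := by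
  unfold G; split_ifs <;> norm_num

theorem lintegral_G_sq (t : ℝ) :
    (∫⁻ x, ENNReal.ofReal (G t x ^ 2)) = ENNReal.ofReal (t / 2) := by
  have h : ∀ x, ENNReal.ofReal (G t x ^ 2) =
      (Set.Ioo (-t) t).indicator (fun _ => ENNReal.ofReal (1 / 4)) x := by
    intro x
    by_cases hx : |x| < t
    · rw [Set.indicator_of_mem (by exact abs_lt.mp hx)]
      simp only [G, if_pos hx]; norm_num
    · rw [Set.indicator_of_notMem (by rwa [Set.mem_Ioo, ← abs_lt])]
      simp [G, hx]
  simp_rw [h]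
  rw [lintegral_indicator_const measurableSet_Ioo, Real.volume_Ioo,
    ← ENNReal.ofReal_mul (by norm_num)]
  congr 1; ring

theorem lintegral_G_sub_sq_le_abs (t h : ℝ) :
    (∫⁻ x, ENNReal.ofReal ((G t (x + h) - G t x) ^ 2)) ≤ ENNReal.ofReal |h| := by
  have key : ∀ x, ENNReal.ofReal ((G t (x + h) - G t x) ^ 2) ≤
      (Metric.closedBall (-t) |h|).indicator (fun _ => ENNReal.ofReal (1 / 4)) x +
      (Metric.closedBall t |h|).indicator (fun _ => ENNReal.ofReal (1 / 4)) x := by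
    intro x
    have hsq : (G t (x + h) - G t x) ^ 2 ≤ 1 / 4 := by
      unfold G; split_ifs <;> norm_num
    by_cases h1 : x ∈ Metric.closedBall (-t) |h|
    · rw [Set.indicator_of_mem h1]
      exact (ENNReal.ofReal_le_ofReal hsq).trans le_self_add
    by_cases h2 : x ∈ Metric.closedBall t |h|
    · rw [Set.indicator_of_mem h2]
      exact (ENNReal.ofReal_le_ofReal hsq).trans le_add_self
    have : G t (x + h) = G t x := by
      rw [Metric.mem_closedBall, Real.dist_eq, not_le] at h1 h2
      unfold G
      have : |x + h| < t ↔ |x| < t := by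
        rw [abs_lt, abs_lt]
        rw [lt_abs] at h1 h2
        have := neg_abs_le h
        have := le_abs_self h
        constructor <;> rintro ⟨h3, h4⟩ <;> constructor <;>
          rcases h1 with h1 | h1 <;> rcases h2 with h2 | h2 <;> linarith
      simp only [this]
    simp [this]
  refine (lintegral_mono key).trans ?_
  rw [lintegral_add_left (measurable_const.indicator measurableSet_closedBall),
    lintegral_indicator_const measurableSet_closedBall,
    lintegral_indicator_const measurableSet_closedBall, Real.volume_closedBall,
    Real.volume_closedBall, ← ENNReal.ofReal_mul (by norm_num),
    ← ENNReal.ofReal_add (by positivity) (by positivity)]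
  exact ENNReal.ofReal_le_ofReal (by linarith)

theorem lintegral_G_sub_sq_le {t : ℝ} (ht : 0 < t) (h : ℝ) :
    (∫⁻ x, ENNReal.ofReal ((G t (x + h) - G t x) ^ 2)) ≤ ENNReal.ofReal (min |h| t) := by
  rw [ENNReal.ofReal_min]
  refine le_min (lintegral_G_sub_sq_le_abs t h) ?_
  have key : ∀ x, ENNReal.ofReal ((G t (x + h) - G t x) ^ 2) ≤
      ENNReal.ofReal (G t (x + h) ^ 2) + ENNReal.ofReal (G t x ^ 2) := by
    intro x
    rw [← ENNReal.ofReal_add (sq_nonneg _) (sq_nonneg _)]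
    exact ENNReal.ofReal_le_ofReal
      (by nlinarith [mul_nonneg (G_nonneg t (x + h)) (G_nonneg t x)])
  refine (lintegral_mono key).trans ?_
  have hG := measurable_G t
  rw [lintegral_add_right _ (by fun_prop),
    lintegral_add_right_eq_self (fun x => ENNReal.ofReal (G t x ^ 2)) h, lintegral_G_sq t,
    ← ENNReal.ofReal_add (by positivity) (by positivity)]
  exact ENNReal.ofReal_le_ofReal (by linarith)

theorem lintegral_second_diff_sq_le {f : ℝ → ℝ} (hf : Measurable f) (y h : ℝ) :
    (∫⁻ x, ENNReal.ofReal ((f (x + y + h) - f (x + y) - f (x + h) + f x) ^ 2)) ≤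
      4 * ∫⁻ x, ENNReal.ofReal ((f (x + h) - f x) ^ 2) := by
  have key : ∀ x, ENNReal.ofReal ((f (x + y + h) - f (x + y) - f (x + h) + f x) ^ 2) ≤
      2 * ENNReal.ofReal ((f (x + y + h) - f (x + y)) ^ 2) +
      2 * ENNReal.ofReal ((f (x + h) - f x) ^ 2) := by
    intro x
    rw [show (2 : ENNReal) = ENNReal.ofReal 2 by simp, ← ENNReal.ofReal_mul (by norm_num),
      ← ENNReal.ofReal_mul (by norm_num), ← ENNReal.ofReal_add (by positivity) (by positivity)]
    exact ENNReal.ofReal_le_ofReal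
      (by nlinarith [sq_nonneg (f (x + y + h) - f (x + y) + (f (x + h) - f x))])
  refine (lintegral_mono key).trans ?_
  rw [lintegral_add_right _ (by fun_prop), lintegral_const_mul _ (by fun_prop),
    lintegral_const_mul _ (by fun_prop),
    lintegral_add_right_eq_self (fun x => ENNReal.ofReal ((f (x + h) - f x) ^ 2)) y, ← add_mul]
  norm_num

theorem lintegral_second_diff_G_sq_le {t : ℝ} (ht : 0 < t) (y h : ℝ) :
    (∫⁻ x, ENNReal.ofReal ((G t (x + y + h) - G t (x + y) - G t (x + h) + G t x) ^ 2)) ≤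
      4 * ENNReal.ofReal (min (min |h| |y|) t) := by
  rw [show min (min |h| |y|) t = min (min |h| t) (min |y| t) by
    rw [min_min_min_comm, min_self], ENNReal.ofReal_min, mul_min]
  refine le_min ?_ ?_
  · exact (lintegral_second_diff_sq_le (measurable_G t) y h).trans
      (by gcongr; exact lintegral_G_sub_sq_le ht h)
  · refine le_trans (le_of_eq ?_) ((lintegral_second_diff_sq_le (measurable_G t) h y).trans
      (mul_le_mul_right (lintegral_G_sub_sq_le ht y) 4))
    refine lintegral_congr fun x => ?_
    rw [add_right_comm x y h]
    congr 2; ring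

theorem lintegral_rpow_Ioi {a r : ℝ} (ha : a < -1) (hr : 0 < r) :
    (∫⁻ y in Set.Ioi r, ENNReal.ofReal (|y| ^ a)) = ENNReal.ofReal (-r ^ (a + 1) / (a + 1)) := by
  rw [← integral_Ioi_rpow_of_lt ha hr, ofReal_integral_eq_lintegral_ofReal
    (integrableOn_Ioi_rpow_of_lt ha hr)]
  · refine setLIntegral_congr_fun measurableSet_Ioi fun y hy => ?_
    simp only [abs_of_pos (hr.trans hy)]
  · filter_upwards [ae_restrict_mem measurableSet_Ioi] with y hy
    exact Real.rpow_nonneg (hr.trans hy).le _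

theorem lintegral_rpow_abs_gt {a r : ℝ} (ha : a < -1) (hr : 0 < r) :
    (∫⁻ y, {y : ℝ | r < |y|}.indicator (fun y => ENNReal.ofReal (|y| ^ a)) y) =
      ENNReal.ofReal (2 * (-r ^ (a + 1) / (a + 1))) := by
  have hm : MeasurableSet {y : ℝ | r < |y|} := measurableSet_lt measurable_const measurable_norm
  rw [lintegral_indicator hm]
  have hset : {y : ℝ | r < |y|} = Set.Ioi r ∪ Set.Iio (-r) := by
    ext y; simp [lt_abs, lt_neg]
  have hneg : (∫⁻ y in Set.Iio (-r), ENNReal.ofReal (|y| ^ a)) =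
      ∫⁻ y in Set.Ioi r, ENNReal.ofReal (|y| ^ a) := by
    rw [← (Measure.measurePreserving_neg (volume : Measure ℝ)).setLIntegral_comp_preimage_emb
      (MeasurableEquiv.neg ℝ).measurableEmbedding]
    simp
  rw [hset, lintegral_union measurableSet_Iio, hneg, lintegral_rpow_Ioi ha hr, ← two_mul,
    ENNReal.ofReal_mul (by norm_num)]
  · simp
  · rw [Set.disjoint_left]
    intro y hy hy'
    simp only [Set.mem_Ioi, Set.mem_Iio] at hy hy'
    linarith

theorem ofReal_min_mul_eq_lintegral (u v : ℝ → ENNReal) (t y h : ℝ) :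
    ENNReal.ofReal (min (min |h| |y|) t) * (u h * v y) =
      ∫⁻ r in Set.Ioo 0 t, {h : ℝ | r < |h|}.indicator u h * {y : ℝ | r < |y|}.indicator v y := by
  have : ∀ r, {h : ℝ | r < |h|}.indicator u h * {y : ℝ | r < |y|}.indicator v y =
      (Set.Iio (min |h| |y|)).indicator (fun _ => u h * v y) r := by
    intro r
    by_cases h1 : r < |h| <;> by_cases h2 : r < |y| <;> simp [Set.indicator, h1, h2]
  simp_rw [this]
  rw [lintegral_indicator_const measurableSet_Iio, Measure.restrict_apply measurableSet_Iio,
    Set.inter_comm, Set.Ioo_inter_Iio, Real.volume_Ioo, mul_comm, sub_zero, min_comm t]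

theorem lintegral_min_mul_rpow {a t : ℝ} (ha : a < -1) (ha' : -1 < 2 * (a + 1)) (ht : 0 < t) :
    (∫⁻ h : ℝ, ∫⁻ y : ℝ, ENNReal.ofReal (min (min |h| |y|) t) *
        (ENNReal.ofReal (|h| ^ a) * ENNReal.ofReal (|y| ^ a))) =
      ENNReal.ofReal (4 / (a + 1) ^ 2 / (2 * a + 3) * t ^ (2 * a + 3)) := by
  have hw : Measurable fun y : ℝ => ENNReal.ofReal (|y| ^ a) := by fun_prop
  have hA : Measurable fun p : ℝ × ℝ =>
      {y : ℝ | p.1 < |y|}.indicator (fun y => ENNReal.ofReal (|y| ^ a)) p.2 := by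
    have : Measurable ({p : ℝ × ℝ | p.1 < |p.2|}.indicator
        fun p => ENNReal.ofReal (|p.2| ^ a)) :=
      (hw.comp measurable_snd).indicator
        (measurableSet_lt measurable_fst measurable_snd.norm)
    exact this
  have hA' : ∀ r, Measurable ({y : ℝ | r < |y|}.indicator fun y => ENNReal.ofReal (|y| ^ a)) :=
    fun r => hw.indicator (measurableSet_lt measurable_const measurable_norm)
  simp_rw [ofReal_min_mul_eq_lintegral (fun y => ENNReal.ofReal (|y| ^ a))
    (fun y => ENNReal.ofReal (|y| ^ a))]
  rw [← lintegral_rotate]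
  · simp_rw [lintegral_const_mul _ (hA' _), lintegral_mul_const _ (hA' _)]
    have hpow : ∀ r ∈ Set.Ioo 0 t,
        (∫⁻ y, {y : ℝ | r < |y|}.indicator (fun y => ENNReal.ofReal (|y| ^ a)) y) *
        (∫⁻ y, {y : ℝ | r < |y|}.indicator (fun y => ENNReal.ofReal (|y| ^ a)) y) =
        ENNReal.ofReal (4 / (a + 1) ^ 2 * r ^ (2 * (a + 1))) := by
      intro r hr
      have h0 : 0 ≤ r ^ (a + 1) := Real.rpow_nonneg hr.1.le _
      rw [lintegral_rpow_abs_gt ha hr.1, ← ENNReal.ofReal_mul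
        (mul_nonneg zero_le_two (div_nonneg_of_nonpos (by linarith) (by linarith))),
        two_mul (a + 1), Real.rpow_add hr.1 (a + 1) (a + 1)]
      congr 1
      generalize r ^ (a + 1) = s
      generalize a + 1 = b
      ring
    rw [setLIntegral_congr_fun measurableSet_Ioo hpow, restrict_Ioo_eq_restrict_Ioc,
      ← ofReal_integral_eq_lintegral_ofReal, ← intervalIntegral.integral_of_le ht.le,
      intervalIntegral.integral_const_mul, integral_rpow (Or.inl ha'),
      Real.zero_rpow (by linarith)]
    · congr 1
      rw [show 2 * (a + 1) + 1 = 2 * a + 3 by ring]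
      ring
    · exact ((intervalIntegral.intervalIntegrable_rpow' ha').const_mul _).1
    · filter_upwards [ae_restrict_mem measurableSet_Ioc] with r hr
      have := Real.rpow_nonneg hr.1.le (2 * (a + 1))
      positivity
  · exact (hA.comp measurable_fst).mul
      (hA.comp (by fun_prop : Measurable fun p : (ℝ × ℝ) × ℝ => (p.1.1, p.2)))

theorem stmt6 (H : ℝ) (hH : H ∈ Set.Ioo (1 / 4 : ℝ) (1 / 2 : ℝ)) :
    ∃ C : ℝ, 0 < C ∧ ∀ t : ℝ, 0 < t →
      (∫⁻ x : ℝ, ∫⁻ h : ℝ, ∫⁻ y : ℝ,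
          ENNReal.ofReal ((G t (x + y + h) - G t (x + y) - G t (x + h) + G t x) ^ 2 *
            (|y| ^ (2 * H - 2) * |h| ^ (2 * H - 2))))
        ≤ ENNReal.ofReal (C * t ^ (4 * H - 1)) := by
  obtain ⟨hH1, hH2⟩ := hH
  have hC : 0 < 4 / (2 * H - 2 + 1) ^ 2 / (2 * (2 * H - 2) + 3) :=
    div_pos (div_pos (by norm_num) (sq_pos_of_neg (by linarith))) (by linarith)
  refine ⟨4 * (4 / (2 * H - 2 + 1) ^ 2 / (2 * (2 * H - 2) + 3)), by positivity, fun t ht => ?_⟩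
  have hG := measurable_G t
  rw [lintegral_rotate (by fun_prop)]
  calc
    _ ≤ ∫⁻ h : ℝ, ∫⁻ y : ℝ, 4 * (ENNReal.ofReal (min (min |h| |y|) t) *
        (ENNReal.ofReal (|h| ^ (2 * H - 2)) * ENNReal.ofReal (|y| ^ (2 * H - 2)))) := by
      refine lintegral_mono fun h => lintegral_mono fun y => ?_
      simp_rw [ENNReal.ofReal_mul (sq_nonneg _)]
      rw [lintegral_mul_const _ (by fun_prop), ENNReal.ofReal_mul (by positivity),
        mul_comm (ENNReal.ofReal (|y| ^ (2 * H - 2))), ← mul_assoc 4]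
      gcongr
      exact lintegral_second_diff_G_sq_le ht y h
    _ = _ := by
      simp_rw [lintegral_const_mul' 4 _ (by norm_num)]
      rw [lintegral_min_mul_rpow (by linarith) (by linarith) ht, mul_assoc,
        ENNReal.ofReal_mul (p := 4) (by norm_num)]
      congr 1
      · simp
      · congr 3; ring
end
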